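/- arXiv:1901.00733 — 7 statements merged into one kernel-verified Lean document; each statement's English description precedes it below -/
import Mathlib

section
/- Fix reals δ > c ≥ 0, β > 0, τ ∈ [0, β], and a price p with p̃ ≤ p ≤ δ, where p̃ = c + (δ − c)(1 − F(τ)). Let f : ℝ → ℝ be a continuous, strictly positive density on [0, β] with CDF F(t) = ∫_0^t f(ξ)dξ, F(β) = 1, and let x* ∈ [0, τ] be the unique point with F(τ − x*) = (δ − p)/(δ − c). Then x* is the unique maximizer over [0, τ] of the MU payoff U_n(x) = (δ − c)·(∫_0^{τ−x} ξ f(ξ)dξ + (τ−x)(1 − F(τ−x))) − (δ − c)·(∫_0^{τ} ξ f(ξ)dξ + τ(1 − F(τ))) + (p − c)·x. -/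
open MeasureTheory intervalIntegral

/-- For a density positive on `[0, β]`, the first moment about `t` from `t` to `s` is positive,
whichever of the two points is larger. -/
theorem integral_sub_mul_pos_of_ne {f : ℝ → ℝ} {β s t : ℝ}
    (hf_cont : ContinuousOn f (Set.Icc 0 β)) (hf_pos : ∀ ξ ∈ Set.Icc (0 : ℝ) β, 0 < f ξ)
    (hs : s ∈ Set.Icc 0 β) (ht : t ∈ Set.Icc 0 β) (hst : t ≠ s) :
    0 < ∫ ξ in t..s, (ξ - t) * f ξ := by
  have hsub : Set.uIcc t s ⊆ Set.Icc 0 β := Set.uIcc_subset_Icc ht hs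
  have hint : IntervalIntegrable (fun ξ => (ξ - t) * f ξ) volume t s :=
    ((continuousOn_id.sub continuousOn_const).mul (hf_cont.mono hsub)).intervalIntegrable
  rcases lt_or_gt_of_ne hst with h | h
  · refine intervalIntegral_pos_of_pos_on hint (fun ξ hξ => ?_) h
    exact mul_pos (sub_pos.2 hξ.1) (hf_pos ξ ⟨ht.1.trans hξ.1.le, hξ.2.le.trans hs.2⟩)
  · rw [integral_symm, ← intervalIntegral.integral_neg]
    refine intervalIntegral_pos_of_pos_on hint.symm.neg (fun ξ hξ => ?_) h
    have := mul_pos (sub_pos.2 hξ.2) (hf_pos ξ ⟨hs.1.trans hξ.1.le, hξ.2.le.trans ht.2⟩)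
    linarith

/-- Middle case of Lemma 1: for a price `p ∈ [p̃, δ]`, the unique solution
`x*` of `F(τ - x*) = (δ - p)/(δ - c)` is the unique maximizer of the MU
payoff `U_n` over `[0, τ]`. -/
theorem stmt_4 (δ c β τ p : ℝ) (hδc : c < δ) (hc : 0 ≤ c) (hβ : 0 < β)
    (hτ : τ ∈ Set.Icc 0 β) (f F Un : ℝ → ℝ)
    (hf_cont : ContinuousOn f (Set.Icc 0 β))
    (hf_pos : ∀ ξ ∈ Set.Icc (0:ℝ) β, 0 < f ξ)
    (hF : ∀ t, F t = ∫ ξ in (0:ℝ)..t, f ξ)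
    (hFβ : F β = 1)
    (hp₁ : c + (δ - c) * (1 - F τ) ≤ p) (hp₂ : p ≤ δ)
    (xstar : ℝ) (hxstar_mem : xstar ∈ Set.Icc 0 τ)
    (hxstar_eq : F (τ - xstar) = (δ - p) / (δ - c))
    (hUn : ∀ x, Un x =
      (δ - c) * ((∫ ξ in (0:ℝ)..(τ - x), ξ * f ξ) + (τ - x) * (1 - F (τ - x)))
      - (δ - c) * ((∫ ξ in (0:ℝ)..τ, ξ * f ξ) + τ * (1 - F τ))
      + (p - c) * x) :
    ∀ x ∈ Set.Icc (0:ℝ) τ, x ≠ xstar → Un x < Un xstar := by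
  intro x hx hne
  have hs : τ - xstar ∈ Set.Icc 0 β :=
    ⟨sub_nonneg.2 hxstar_mem.2, by linarith [hxstar_mem.1, hτ.2]⟩
  have ht : τ - x ∈ Set.Icc 0 β := ⟨sub_nonneg.2 hx.2, by linarith [hx.1, hτ.2]⟩
  have hpos := integral_sub_mul_pos_of_ne hf_cont hf_pos hs ht
    (fun h => hne (by linarith))
  have hfint : ∀ a ∈ Set.Icc 0 β, ∀ b ∈ Set.Icc 0 β, IntervalIntegrable f volume a b :=
    fun a ha b hb => (hf_cont.mono (Set.uIcc_subset_Icc ha hb)).intervalIntegrable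
  have hgint : ∀ a ∈ Set.Icc 0 β, ∀ b ∈ Set.Icc 0 β,
      IntervalIntegrable (fun ξ => ξ * f ξ) volume a b :=
    fun a ha b hb => (hfint a ha b hb).continuousOn_mul continuousOn_id
  have h0 : (0 : ℝ) ∈ Set.Icc 0 β := ⟨le_rfl, hβ.le⟩
  have hF_sub := integral_interval_sub_left (hfint 0 h0 _ hs) (hfint 0 h0 _ ht)
  have hG_sub := integral_interval_sub_left (hgint 0 h0 _ hs) (hgint 0 h0 _ ht)
  rw [← hF, ← hF] at hF_sub
  have hsplit : ∫ ξ in (τ - x)..(τ - xstar), (ξ - (τ - x)) * f ξ =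
      (∫ ξ in (τ - x)..(τ - xstar), ξ * f ξ) -
        (τ - x) * ∫ ξ in (τ - x)..(τ - xstar), f ξ := by
    simp only [sub_mul _ (τ - x)]
    rw [intervalIntegral.integral_sub (hgint _ ht _ hs) ((hfint _ ht _ hs).const_mul _),
      intervalIntegral.integral_const_mul]
  rw [hsplit, ← hF_sub, ← hG_sub] at hpos
  have hprice : p - c = (δ - c) * (1 - F (τ - xstar)) := by
    rw [hxstar_eq, mul_sub, mul_div_cancel₀ _ (sub_pos.2 hδc).ne']
    ring
  have hgain := mul_pos (sub_pos.2 hδc) hpos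
  rw [hUn, hUn, hprice]
  linarith
end

section
/- Fix reals δ > c ≥ 0, β > 0, τ ∈ (0, β], and a price p with 0 ≤ p < p̃, where p̃ = c + (δ − c)(1 − F(τ)). Let f : ℝ → ℝ be a continuous, strictly positive density on [0, β] with CDF F(t) = ∫_0^t f(ξ)dξ, F(β) = 1. Then x = 0 is the unique maximizer over [0, τ] of the MU payoff U_n(x) = (δ − c)·(∫_0^{τ−x} ξ f(ξ)dξ + (τ−x)(1 − F(τ−x))) − (δ − c)·(∫_0^{τ} ξ f(ξ)dξ + τ(1 − F(τ))) + (p − c)·x; indeed U_n is strictly decreasing on [0, τ]. -/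
open MeasureTheory intervalIntegral

/-- The function `t ↦ ∫₀ᵗ ξ f(ξ) dξ + t (1 - ∫₀ᵗ f)` grows on `[s, t]` at least at
the rate `1 - ∫₀ᵗ f`. -/
theorem sub_mul_one_sub_integral_le {f : ℝ → ℝ} {s t : ℝ} (hs : 0 ≤ s) (hst : s ≤ t)
    (hf : ContinuousOn f (Set.Icc 0 t)) (hf₀ : ∀ ξ ∈ Set.Icc 0 t, 0 ≤ f ξ) :
    (t - s) * (1 - ∫ ξ in (0:ℝ)..t, f ξ) ≤
      ((∫ ξ in (0:ℝ)..t, ξ * f ξ) + t * (1 - ∫ ξ in (0:ℝ)..t, f ξ)) -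
        ((∫ ξ in (0:ℝ)..s, ξ * f ξ) + s * (1 - ∫ ξ in (0:ℝ)..s, f ξ)) := by
  have hint : ∀ {g : ℝ → ℝ}, ContinuousOn g (Set.Icc 0 t) →
      IntervalIntegrable g volume 0 s ∧ IntervalIntegrable g volume s t := fun hg =>
    ⟨(hg.mono (Set.Icc_subset_Icc_right hst)).intervalIntegrable_of_Icc hs,
      (hg.mono (Set.Icc_subset_Icc_left hs)).intervalIntegrable_of_Icc hst⟩
  have hfi := hint hf
  have hgi := hint (continuousOn_id.mul hf)
  have hmono : (∫ ξ in s..t, s * f ξ) ≤ ∫ ξ in s..t, ξ * f ξ :=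
    integral_mono_on hst (hfi.2.const_mul s) hgi.2 fun ξ hξ =>
      mul_le_mul_of_nonneg_right hξ.1 (hf₀ ξ ⟨hs.trans hξ.1, hξ.2⟩)
  rw [intervalIntegral.integral_const_mul] at hmono
  have hadd := integral_add_adjacent_intervals hfi.1 hfi.2
  have hadd' : (∫ ξ in (0:ℝ)..s, ξ * f ξ) + (∫ ξ in s..t, ξ * f ξ) =
      ∫ ξ in (0:ℝ)..t, ξ * f ξ := integral_add_adjacent_intervals hgi.1 hgi.2
  rw [← hadd, ← hadd']
  linarith

/-- The integral of a nonnegative continuous function is monotone in the upper endpoint. -/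
theorem integral_le_integral_of_le_right {f : ℝ → ℝ} {s t : ℝ} (hs : 0 ≤ s) (hst : s ≤ t)
    (hf : ContinuousOn f (Set.Icc 0 t)) (hf₀ : ∀ ξ ∈ Set.Icc 0 t, 0 ≤ f ξ) :
    (∫ ξ in (0:ℝ)..s, f ξ) ≤ ∫ ξ in (0:ℝ)..t, f ξ := by
  rw [← integral_add_adjacent_intervals
    ((hf.mono (Set.Icc_subset_Icc_right hst)).intervalIntegrable_of_Icc hs)
    ((hf.mono (Set.Icc_subset_Icc_left hs)).intervalIntegrable_of_Icc hst)]
  exact le_add_of_nonneg_right <|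
    integral_nonneg hst fun ξ hξ => hf₀ ξ ⟨hs.trans hξ.1, hξ.2⟩

/-- Low-price case of Lemma 1: for a price `0 ≤ p < p̃ = c + (δ - c)(1 - F τ)`,
the MU payoff `U_n` is strictly decreasing on `[0, τ]` and `x = 0` is its
unique maximizer over `[0, τ]`. -/
theorem stmt_5 (δ c β τ p : ℝ) (hδc : c < δ) (hc : 0 ≤ c) (hβ : 0 < β)
    (hτ : τ ∈ Set.Ioc 0 β) (f F Un : ℝ → ℝ)
    (hf_cont : ContinuousOn f (Set.Icc 0 β))
    (hf_pos : ∀ ξ ∈ Set.Icc (0:ℝ) β, 0 < f ξ)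
    (hF : ∀ t, F t = ∫ ξ in (0:ℝ)..t, f ξ)
    (hFβ : F β = 1)
    (hp₁ : 0 ≤ p) (hp₂ : p < c + (δ - c) * (1 - F τ))
    (hUn : ∀ x, Un x =
      (δ - c) * ((∫ ξ in (0:ℝ)..(τ - x), ξ * f ξ) + (τ - x) * (1 - F (τ - x)))
      - (δ - c) * ((∫ ξ in (0:ℝ)..τ, ξ * f ξ) + τ * (1 - F τ))
      + (p - c) * x) :
    (∀ x ∈ Set.Icc (0:ℝ) τ, x ≠ 0 → Un x < Un 0) ∧
      StrictAntiOn Un (Set.Icc 0 τ) := by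
  have hanti : StrictAntiOn Un (Set.Icc 0 τ) := by
    intro x hx y hy hxy
    have hcont : ∀ {t}, t ≤ τ → ContinuousOn f (Set.Icc 0 t) := fun ht =>
      hf_cont.mono (Set.Icc_subset_Icc_right (ht.trans hτ.2))
    have hnonneg : ∀ {t}, t ≤ τ → ∀ ξ ∈ Set.Icc 0 t, 0 ≤ f ξ := fun ht ξ hξ =>
      (hf_pos ξ ⟨hξ.1, hξ.2.trans (ht.trans hτ.2)⟩).le
    have hxτ : τ - x ≤ τ := sub_le_self τ hx.1
    have hgrowth := sub_mul_one_sub_integral_le (sub_nonneg.2 hy.2)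
      (sub_le_sub_left hxy.le τ) (hcont hxτ) (hnonneg hxτ)
    have hFle := integral_le_integral_of_le_right (sub_nonneg.2 hx.2) hxτ
      (hcont le_rfl) (hnonneg le_rfl)
    simp only [← hF] at hgrowth hFle
    have hδ : 0 < δ - c := sub_pos.2 hδc
    have hyx : 0 < y - x := sub_pos.2 hxy
    have hrate := mul_le_mul_of_nonneg_left hgrowth hδ.le
    have hFrate := mul_le_mul_of_nonneg_left hFle (mul_pos hδ hyx).le
    have hprice := mul_lt_mul_of_pos_left hp₂ hyx
    rw [hUn x, hUn y]
    linarith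
  exact ⟨fun x hx hx₀ =>
    hanti (Set.left_mem_Icc.2 hτ.1.le) hx (lt_of_le_of_ne hx.1 hx₀.symm), hanti⟩
end

section
/- Fix reals δ > c ≥ 0, β > 0, τ ∈ (0, β], and a price p > δ. Let f : ℝ → ℝ be a continuous, strictly positive density on [0, β] with CDF F(t) = ∫_0^t f(ξ)dξ, F(β) = 1. Then x = τ is the unique maximizer over [0, τ] of the MU payoff U_n(x) = (δ − c)·(∫_0^{τ−x} ξ f(ξ)dξ + (τ−x)(1 − F(τ−x))) − (δ − c)·(∫_0^{τ} ξ f(ξ)dξ + τ(1 − F(τ))) + (p − c)·x; indeed U_n is strictly increasing on [0, τ]. -/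
open MeasureTheory intervalIntegral

/-- The expected served demand at capacity `t` grows at most at unit rate in `t`. -/
lemma expected_served_demand_sub_le {f : ℝ → ℝ} {β s t : ℝ}
    (hf_cont : ContinuousOn f (Set.Icc 0 β)) (hf_nonneg : ∀ ξ ∈ Set.Icc (0:ℝ) β, 0 ≤ f ξ)
    (hs : 0 ≤ s) (hst : s ≤ t) (ht : t ≤ β) :
    ((∫ ξ in (0:ℝ)..t, ξ * f ξ) + t * (1 - ∫ ξ in (0:ℝ)..t, f ξ)) -
      ((∫ ξ in (0:ℝ)..s, ξ * f ξ) + s * (1 - ∫ ξ in (0:ℝ)..s, f ξ)) ≤ t - s := by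
  have integrable {g : ℝ → ℝ} (hg : ContinuousOn g (Set.Icc 0 β)) {a b : ℝ}
      (ha : 0 ≤ a) (hab : a ≤ b) (hb : b ≤ β) : IntervalIntegrable g volume a b :=
    (hg.mono (Set.Icc_subset_Icc ha hb)).intervalIntegrable_of_Icc hab
  have hg_cont : ContinuousOn (fun ξ => ξ * f ξ) (Set.Icc 0 β) := continuousOn_id.mul hf_cont
  have hsβ := hst.trans ht
  have add_f := integral_add_adjacent_intervals
    (integrable hf_cont le_rfl hs hsβ) (integrable hf_cont hs hst ht)
  have add_g := integral_add_adjacent_intervals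
    (integrable hg_cont le_rfl hs hsβ) (integrable hg_cont hs hst ht)
  have cdf_nonneg : 0 ≤ ∫ ξ in (0:ℝ)..s, f ξ :=
    integral_nonneg hs fun ξ hξ => hf_nonneg ξ ⟨hξ.1, hξ.2.trans hsβ⟩
  have mean_le : ∫ ξ in s..t, ξ * f ξ ≤ t * ∫ ξ in s..t, f ξ := by
    rw [← intervalIntegral.integral_const_mul]
    exact integral_mono_on hst (integrable hg_cont hs hst ht)
      ((integrable hf_cont hs hst ht).const_mul t) fun ξ hξ =>
        mul_le_mul_of_nonneg_right hξ.2 (hf_nonneg ξ ⟨hs.trans hξ.1, hξ.2.trans ht⟩)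
  rw [← add_f, ← add_g]
  nlinarith [mul_nonneg (sub_nonneg.2 hst) cdf_nonneg]

/-- High-price case of Lemma 1: for a price `p > δ`, the MU payoff `U_n` is
strictly increasing on `[0, τ]` and `x = τ` is its unique maximizer over
`[0, τ]`. -/
theorem stmt_6 (δ c β τ p : ℝ) (hδc : c < δ) (hc : 0 ≤ c) (hβ : 0 < β)
    (hτ : τ ∈ Set.Ioc 0 β) (f F Un : ℝ → ℝ)
    (hf_cont : ContinuousOn f (Set.Icc 0 β))
    (hf_pos : ∀ ξ ∈ Set.Icc (0:ℝ) β, 0 < f ξ)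
    (hF : ∀ t, F t = ∫ ξ in (0:ℝ)..t, f ξ)
    (hFβ : F β = 1)
    (hp : δ < p)
    (hUn : ∀ x, Un x =
      (δ - c) * ((∫ ξ in (0:ℝ)..(τ - x), ξ * f ξ) + (τ - x) * (1 - F (τ - x)))
      - (δ - c) * ((∫ ξ in (0:ℝ)..τ, ξ * f ξ) + τ * (1 - F τ))
      + (p - c) * x) :
    (∀ x ∈ Set.Icc (0:ℝ) τ, x ≠ τ → Un x < Un τ) ∧
      StrictMonoOn Un (Set.Icc 0 τ) := by
  have mono : StrictMonoOn Un (Set.Icc 0 τ) := by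
    intro x hx y hy hxy
    have key := expected_served_demand_sub_le hf_cont (fun ξ hξ => (hf_pos ξ hξ).le)
      (s := τ - y) (t := τ - x) (by linarith [hy.2]) (by linarith) (by linarith [hx.1, hτ.2])
    rw [← hF, ← hF] at key
    have scaled := mul_le_mul_of_nonneg_left key (sub_nonneg.2 hδc.le)
    have gain := mul_pos (sub_pos.2 hp) (sub_pos.2 hxy)
    rw [hUn x, hUn y]
    linarith
  exact ⟨fun x hx hne => mono hx ⟨hτ.1.le, le_rfl⟩ (lt_of_le_of_ne hx.2 hne), mono⟩
end

section
/- Fix reals δ > c ≥ 0, β > 0, and τ ∈ [0, β]. Let f : ℝ → ℝ be a continuous, strictly positive density on [0, β] with CDF F(t) = ∫_0^t f(ξ)dξ, F(β) = 1, set p̃ = c + (δ − c)(1 − F(τ)), and for p ∈ [p̃, δ] let x*(p) ∈ [0, τ] be the unique point with F(τ − x*(p)) = (δ − p)/(δ − c). If f is nonincreasing on [0, β], then the function p ↦ x*(p) is concave on [p̃, δ]. -/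
open MeasureTheory intervalIntegral

theorem hasDerivAt_integral_of_continuousOn_Icc {f : ℝ → ℝ} {a b x : ℝ}
    (hf : ContinuousOn f (Set.Icc a b)) (hx : x ∈ Set.Ioo a b) :
    HasDerivAt (fun t => ∫ ξ in a..t, f ξ) (f x) x := by
  refine integral_hasDerivAt_right ?_ ?_ (hf.continuousAt (Icc_mem_nhds hx.1 hx.2))
  · refine (hf.mono ?_).intervalIntegrable
    rw [Set.uIcc_of_le hx.1.le]
    exact Set.Icc_subset_Icc_right hx.2.le
  · exact (hf.mono Set.Ioo_subset_Icc_self).stronglyMeasurableAtFilter isOpen_Ioo x hx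

theorem continuousOn_integral_of_continuousOn_Icc {f : ℝ → ℝ} {a b : ℝ} (hab : a ≤ b)
    (hf : ContinuousOn f (Set.Icc a b)) :
    ContinuousOn (fun t => ∫ ξ in a..t, f ξ) (Set.Icc a b) := by
  have h := continuousOn_primitive_interval (μ := volume) (f := f) (a := a) (b := b)
    (by rw [Set.uIcc_of_le hab]; exact hf.integrableOn_Icc)
  rwa [Set.uIcc_of_le hab] at h

theorem concaveOn_integral_of_antitoneOn {f : ℝ → ℝ} {a b : ℝ} (hab : a ≤ b)
    (hf : ContinuousOn f (Set.Icc a b)) (hanti : AntitoneOn f (Set.Icc a b)) :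
    ConcaveOn ℝ (Set.Icc a b) (fun t => ∫ ξ in a..t, f ξ) := by
  refine AntitoneOn.concaveOn_of_deriv (convex_Icc a b)
    (continuousOn_integral_of_continuousOn_Icc hab hf) ?_ ?_ <;> rw [interior_Icc]
  · exact fun x hx =>
      (hasDerivAt_integral_of_continuousOn_Icc hf hx).differentiableAt.differentiableWithinAt
  · intro x hx y hy hxy
    rw [(hasDerivAt_integral_of_continuousOn_Icc hf hx).deriv,
      (hasDerivAt_integral_of_continuousOn_Icc hf hy).deriv]
    exact hanti (Set.Ioo_subset_Icc_self hx) (Set.Ioo_subset_Icc_self hy) hxy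

theorem strictMonoOn_integral_of_pos {f : ℝ → ℝ} {a b : ℝ} (hab : a ≤ b)
    (hf : ContinuousOn f (Set.Icc a b)) (hpos : ∀ x ∈ Set.Icc a b, 0 < f x) :
    StrictMonoOn (fun t => ∫ ξ in a..t, f ξ) (Set.Icc a b) := by
  refine strictMonoOn_of_deriv_pos (convex_Icc a b)
    (continuousOn_integral_of_continuousOn_Icc hab hf) ?_
  intro x hx
  rw [interior_Icc] at hx
  rw [(hasDerivAt_integral_of_continuousOn_Icc hf hx).deriv]
  exact hpos x (Set.Ioo_subset_Icc_self hx)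

/-- If the density `f` is nonincreasing on `[0, β]`, then the MU's best
response `x*(p)` (the unique solution in `[0, τ]` of
`F(τ - x) = (δ - p)/(δ - c)`) is concave in the price `p` on `[p̃, δ]`. -/
theorem stmt_9 (δ c β τ : ℝ) (hδc : c < δ) (hc : 0 ≤ c) (hβ : 0 < β)
    (hτ : τ ∈ Set.Icc 0 β) (f F : ℝ → ℝ)
    (hf_cont : ContinuousOn f (Set.Icc 0 β))
    (hf_pos : ∀ ξ ∈ Set.Icc (0:ℝ) β, 0 < f ξ)
    (hf_anti : AntitoneOn f (Set.Icc 0 β))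
    (hF : ∀ t, F t = ∫ ξ in (0:ℝ)..t, f ξ)
    (hFβ : F β = 1)
    (xstar : ℝ → ℝ)
    (hxstar : ∀ p ∈ Set.Icc (c + (δ - c) * (1 - F τ)) δ,
      xstar p ∈ Set.Icc 0 τ ∧ F (τ - xstar p) = (δ - p) / (δ - c)) :
    ConcaveOn ℝ (Set.Icc (c + (δ - c) * (1 - F τ)) δ) xstar := by
  obtain rfl : F = fun t => ∫ ξ in (0:ℝ)..t, f ξ := funext hF
  have hconc := concaveOn_integral_of_antitoneOn hβ.le hf_cont hf_anti
  have hmono := strictMonoOn_integral_of_pos hβ.le hf_cont hf_pos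
  set F : ℝ → ℝ := fun t => ∫ ξ in (0:ℝ)..t, f ξ
  have hmem : ∀ p ∈ Set.Icc (c + (δ - c) * (1 - F τ)) δ, τ - xstar p ∈ Set.Icc 0 β :=
    fun p hp => ⟨by linarith [(hxstar p hp).1.2], by linarith [(hxstar p hp).1.1, hτ.2]⟩
  refine ⟨convex_Icc _ _, fun p hp q hq a b ha hb hab => ?_⟩
  have hr := convex_Icc _ _ hp hq ha hb hab
  have hle := hconc.2 (hmem p hp) (hmem q hq) ha hb hab
  have hy := convex_Icc _ _ (hmem p hp) (hmem q hq) ha hb hab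
  rw [(hxstar p hp).2, (hxstar q hq).2] at hle
  have heq : F (τ - xstar (a • p + b • q)) =
      a • ((δ - p) / (δ - c)) + b • ((δ - q) / (δ - c)) := by
    rw [(hxstar _ hr).2]
    obtain rfl : b = 1 - a := by linarith
    simp only [smul_eq_mul]
    ring
  rw [← heq, hmono.le_iff_le (hmem _ hr) hy] at hle
  simp only [smul_eq_mul] at hle ⊢
  linear_combination hle + τ * hab
end

section
/- Fix λ > 0 and N ≥ 1. For each n, let x_n : ℝ → ℝ be differentiable, and let a_n < b_n be reals such that x_n(p) ≥ 0 and x_n'(p) > 0 for all p ∈ [a_n, b_n]. Define U(p) = λ·ln(1 + Σ_{i=1}^N ln(1 + x_i(p_i))) − Σ_{i=1}^N p_i·x_i(p_i) for p in the box B = ∏_{n=1}^N [a_n, b_n]. If p* ∈ B maximizes U over B, then for every n with p*_n > a_n, the optimal price satisfies p*_n ≤ λ / ((1 + Σ_{i=1}^N ln(1 + x_i(p*_i)))·(1 + x_n(p*_n))). -/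
/-- The derivative of a separable sum along a single coordinate. -/
theorem hasDerivAt_sum_update {ι : Type*} [Fintype ι] [DecidableEq ι] (F : ι → ℝ → ℝ)
    (p : ι → ℝ) (n : ι) {d : ℝ} (h : HasDerivAt (F n) d (p n)) :
    HasDerivAt (fun t => ∑ i, F i (Function.update p n t i)) d (p n) := by
  have key : (fun t => ∑ i, F i (Function.update p n t i)) =
      fun t => F n t + ∑ i ∈ Finset.univ.erase n, F i (p i) := by
    funext t
    rw [← Finset.add_sum_erase _ _ (Finset.mem_univ n), Function.update_self]
    congr 1
    refine Finset.sum_congr rfl fun i hi => ?_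
    rw [Function.update_of_ne (Finset.ne_of_mem_erase hi)]
  rw [key]
  exact h.add_const _

/-- The derivative is nonnegative at the right endpoint of an interval where `f` is maximal. -/
theorem HasDerivAt.nonneg_of_forall_Icc_le {f : ℝ → ℝ} {d a c : ℝ} (h : HasDerivAt f d c)
    (hac : a < c) (hmax : ∀ t ∈ Set.Icc a c, f t ≤ f c) : 0 ≤ d := by
  have ht := (hasDerivWithinAt_iff_tendsto_slope' (s := Set.Iio c) (by simp)).1
    h.hasDerivWithinAt
  refine ge_of_tendsto ht ?_
  filter_upwards [Ioo_mem_nhdsLT hac] with t ht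
  rw [slope_def_field]
  exact div_nonneg_of_nonpos (sub_nonpos.2 (hmax t ⟨ht.1.le, ht.2.le⟩)) (sub_nonpos.2 ht.2.le)


/-- Lemma 2: if `p*` maximizes the SP payoff
`U(p) = λ ln(1 + Σᵢ ln(1 + xᵢ(pᵢ))) - Σᵢ pᵢ xᵢ(pᵢ)` over the box
`∏ₙ [aₙ, bₙ]`, then for every `n` with `p*ₙ > aₙ`, the optimal price satisfies
`p*ₙ ≤ λ / ((1 + Σᵢ ln(1 + xᵢ(p*ᵢ)))(1 + xₙ(p*ₙ)))`. -/
theorem stmt_12 (lam : ℝ) (hlam : 0 < lam) (N : ℕ) (hN : 1 ≤ N)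
    (x : Fin N → ℝ → ℝ) (hdiff : ∀ n, Differentiable ℝ (x n))
    (a b : Fin N → ℝ) (hab : ∀ n, a n < b n)
    (hpos : ∀ n, ∀ p ∈ Set.Icc (a n) (b n), 0 ≤ x n p)
    (hderiv : ∀ n, ∀ p ∈ Set.Icc (a n) (b n), 0 < deriv (x n) p)
    (U : (Fin N → ℝ) → ℝ)
    (hU : ∀ p, U p = lam * Real.log (1 + ∑ i, Real.log (1 + x i (p i)))
      - ∑ i, p i * x i (p i))
    (pstar : Fin N → ℝ) (hmem : ∀ n, pstar n ∈ Set.Icc (a n) (b n))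
    (hmax : ∀ p : Fin N → ℝ, (∀ n, p n ∈ Set.Icc (a n) (b n)) → U p ≤ U pstar) :
    ∀ n, a n < pstar n →
      pstar n ≤ lam /
        ((1 + ∑ i, Real.log (1 + x i (pstar i))) * (1 + x n (pstar n))) := by
  intro n hn
  have hx : 0 ≤ x n (pstar n) := hpos n _ (hmem n)
  have hd := hderiv n _ (hmem n)
  have hS : 0 < 1 + ∑ i, Real.log (1 + x i (pstar i)) := by
    have : 0 ≤ ∑ i, Real.log (1 + x i (pstar i)) :=
      Finset.sum_nonneg fun i _ => Real.log_nonneg (by linarith [hpos i _ (hmem i)])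
    linarith
  have hx' : HasDerivAt (x n) (deriv (x n) (pstar n)) (pstar n) := (hdiff n _).hasDerivAt
  have h1 := hasDerivAt_sum_update (fun i t => Real.log (1 + x i t)) pstar n
    ((hx'.const_add 1).log (by linarith))
  have h2 := hasDerivAt_sum_update (fun i t => t * x i t) pstar n
    ((hasDerivAt_id' (pstar n)).mul hx')
  have h3 := (((h1.const_add 1).log
    (by simpa only [Function.update_eq_self] using hS.ne')).const_mul lam).sub h2
  have h4 := h3.nonneg_of_forall_Icc_le hn (fun t ht => by
    have h5 := hmax (Function.update pstar n t) (fun i => by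
      rcases eq_or_ne i n with rfl | hi
      · rw [Function.update_self]
        exact ⟨ht.1, ht.2.trans (hmem i).2⟩
      · rw [Function.update_of_ne hi]
        exact hmem i)
    rw [hU, hU] at h5
    simpa only [Function.update_eq_self, Pi.sub_apply] using h5)
  simp only [Function.update_eq_self] at h4
  set S := 1 + ∑ i, Real.log (1 + x i (pstar i))
  have h6 : lam * (deriv (x n) (pstar n) / (1 + x n (pstar n)) / S) =
      lam / (S * (1 + x n (pstar n))) * deriv (x n) (pstar n) := by
    have : 1 + x n (pstar n) ≠ 0 := by linarith
    field_simp
  rw [h6] at h4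
  exact le_of_mul_le_mul_right (by linarith) hd
end

section
/- Fix λ > 0 and N ≥ 1. For each n, let x_n : ℝ → ℝ be twice differentiable, and let I_n be an interval such that x_n(p) ≥ 0, x_n'(p) > 0, and x_n''(p) ≤ 0 for all p ∈ I_n. Let S ⊆ ∏_{n=1}^N I_n be a convex set such that for every p ∈ S and every n, p_n ≤ λ / ((1 + Σ_{i=1}^N ln(1 + x_i(p_i)))·(1 + x_n(p_n))). Then the SP payoff U(p) = λ·ln(1 + Σ_{i=1}^N ln(1 + x_i(p_i))) − Σ_{i=1}^N p_i·x_i(p_i) is strictly concave on S. -/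
/-- A continuous function on a convex set of reals is strictly concave if it is twice
differentiable there with negative second derivative. -/
theorem strictConcaveOn_of_hasDerivAt2_neg {D : Set ℝ} (hD : Convex ℝ D) {f f' f'' : ℝ → ℝ}
    (hf : ∀ t ∈ D, HasDerivAt f (f' t) t) (hf' : ∀ t ∈ D, HasDerivAt f' (f'' t) t)
    (hneg : ∀ t ∈ D, f'' t < 0) : StrictConcaveOn ℝ D f := by
  refine strictConcaveOn_of_deriv2_neg hD (fun t ht => (hf t ht).continuousAt.continuousWithinAt)
    fun t ht => ?_
  have heq : deriv f =ᶠ[nhds t] f' := by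
    filter_upwards [isOpen_interior.mem_nhds ht] with s hs
    exact (hf s (interior_subset hs)).deriv
  have h2 : deriv^[2] f t = f'' t := by
    rw [Function.iterate_succ, Function.iterate_one, Function.comp_apply, heq.deriv_eq]
    exact (hf' t (interior_subset ht)).deriv
  exact h2 ▸ hneg t (interior_subset ht)

/-- A function is strictly concave on a convex set if it is strictly concave along every
nondegenerate segment of that set. -/
theorem strictConcaveOn_of_segments {E : Type*} [AddCommGroup E] [Module ℝ E] {S : Set E}
    (hS : Convex ℝ S) {U : E → ℝ}
    (h : ∀ u ∈ S, ∀ v ∈ S, u ≠ v →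
      StrictConcaveOn ℝ (Set.Icc (0 : ℝ) 1) fun t => U (u + t • (v - u))) :
    StrictConcaveOn ℝ S U := by
  refine ⟨hS, fun u hu v hv huv a b ha hb hab => ?_⟩
  have key := (h u hu v hv huv).2 (Set.left_mem_Icc.2 zero_le_one)
    (Set.right_mem_Icc.2 zero_le_one) zero_ne_one ha hb hab
  have hpt : u + b • (v - u) = a • u + b • v := by
    rw [← eq_sub_iff_add_eq] at hab
    rw [hab]
    module
  simpa [hpt] using key

/-- The second derivative of the payoff along a line is negative. Here `y`, `y'`, `y''` are the
values and derivatives of the contributions, `p` the prices and `d` the direction. -/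
theorem payoff_second_deriv_neg {ι : Type*} [Fintype ι] {lam b : ℝ} (hlam : 0 < lam) (hb : 0 < b)
    {y y' y'' p d : ι → ℝ} (hy : ∀ i, 0 ≤ y i) (hy' : ∀ i, 0 < y' i) (hy'' : ∀ i, y'' i ≤ 0)
    (hp : ∀ i, p i ≤ lam / (b * (1 + y i))) (hd : d ≠ 0) :
    lam * (((∑ i, ((y'' i * d i * d i) * (1 + y i) - (y' i * d i) * (y' i * d i)) / (1 + y i) ^ 2)
        * b - (∑ i, y' i * d i / (1 + y i)) * (∑ i, y' i * d i / (1 + y i))) / b ^ 2)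
      - ∑ i, (d i * (y' i * d i) + (d i * (y' i * d i) + p i * (y'' i * d i * d i))) < 0 := by
  have hterm : ∀ i, lam / b * (((y'' i * d i * d i) * (1 + y i) - (y' i * d i) * (y' i * d i))
      / (1 + y i) ^ 2) - (d i * (y' i * d i) + (d i * (y' i * d i) + p i * (y'' i * d i * d i)))
      ≤ -(2 * y' i * d i ^ 2) := by
    intro i
    have h1 : 0 < 1 + y i := by linarith [hy i]
    have e : lam / b * (((y'' i * d i * d i) * (1 + y i) - (y' i * d i) * (y' i * d i))
        / (1 + y i) ^ 2) - (d i * (y' i * d i) + (d i * (y' i * d i) + p i * (y'' i * d i * d i)))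
        = -(2 * y' i * d i ^ 2) - lam / b * (y' i * d i / (1 + y i)) ^ 2
          - (lam / (b * (1 + y i)) - p i) * (-y'' i * d i ^ 2) := by
      field_simp
      ring
    have h2 : 0 ≤ lam / b * (y' i * d i / (1 + y i)) ^ 2 := by positivity
    have h3 : 0 ≤ (lam / (b * (1 + y i)) - p i) * (-y'' i * d i ^ 2) :=
      mul_nonneg (sub_nonneg.2 (hp i)) (mul_nonneg (neg_nonneg.2 (hy'' i)) (sq_nonneg _))
    linarith
  obtain ⟨j, hj⟩ := Function.ne_iff.1 hd
  have hsum : 0 < ∑ i, 2 * y' i * d i ^ 2 :=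
    Finset.sum_pos' (fun i _ => by have := hy' i; positivity)
      ⟨j, Finset.mem_univ j, by have := hy' j; have : d j ≠ 0 := hj; positivity⟩
  have htot := Finset.sum_le_sum fun i (_ : i ∈ Finset.univ) => hterm i
  rw [Finset.sum_sub_distrib, ← Finset.mul_sum, Finset.sum_neg_distrib] at htot
  have hsq : 0 ≤ lam * ((∑ i, y' i * d i / (1 + y i)) ^ 2 / b ^ 2) := by positivity
  have hsplit : ∀ A B : ℝ, lam * ((A * b - B * B) / b ^ 2)
      = lam / b * A - lam * (B ^ 2 / b ^ 2) := by
    intro A B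
    field_simp
  rw [hsplit]
  linarith

/-- Key step of Lemma 3: under the best-response monotonicity/concavity
assumptions and the Lemma-2 price bound, the SP payoff
`U(p) = λ ln(1 + Σᵢ ln(1 + xᵢ(pᵢ))) - Σᵢ pᵢ xᵢ(pᵢ)` is strictly concave on
the convex set `S`. -/
theorem stmt_14 (lam : ℝ) (hlam : 0 < lam) (N : ℕ) (hN : 1 ≤ N)
    (x : Fin N → ℝ → ℝ)
    (hdiff : ∀ n, Differentiable ℝ (x n))
    (hdiff2 : ∀ n, Differentiable ℝ (deriv (x n)))
    (I : Fin N → Set ℝ) (hI : ∀ n, (I n).OrdConnected)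
    (hpos : ∀ n, ∀ p ∈ I n, 0 ≤ x n p)
    (hd1 : ∀ n, ∀ p ∈ I n, 0 < deriv (x n) p)
    (hd2 : ∀ n, ∀ p ∈ I n, deriv (deriv (x n)) p ≤ 0)
    (S : Set (Fin N → ℝ)) (hSsub : S ⊆ Set.univ.pi I) (hSconv : Convex ℝ S)
    (hbound : ∀ p ∈ S, ∀ n, p n ≤
      lam / ((1 + ∑ i, Real.log (1 + x i (p i))) * (1 + x n (p n))))
    (U : (Fin N → ℝ) → ℝ)
    (hU : ∀ p, U p = lam * Real.log (1 + ∑ i, Real.log (1 + x i (p i)))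
      - ∑ i, p i * x i (p i)) :
    StrictConcaveOn ℝ S U := by
  refine strictConcaveOn_of_segments hSconv fun u hu v hv huv => ?_
  set d : Fin N → ℝ := v - u with hd
  have hmem : ∀ t ∈ Set.Icc (0 : ℝ) 1, u + t • d ∈ S := fun t ht =>
    hSconv.add_smul_sub_mem hu hv ht
  have hy : ∀ t ∈ Set.Icc (0 : ℝ) 1, ∀ i, 0 ≤ x i (u i + t * d i) := fun t ht i =>
    hpos i _ (hSsub (hmem t ht) i trivial)
  have hline : ∀ i t, HasDerivAt (fun s => u i + s * d i) (d i) t := fun i t => by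
    simpa using ((hasDerivAt_id t).mul_const (d i)).const_add (u i)
  have hx : ∀ i t, HasDerivAt (fun s => x i (u i + s * d i))
      (deriv (x i) (u i + t * d i) * d i) t := fun i t =>
    (hdiff i _).hasDerivAt.comp t (hline i t)
  have hx' : ∀ i t, HasDerivAt (fun s => deriv (x i) (u i + s * d i) * d i)
      (deriv (deriv (x i)) (u i + t * d i) * d i * d i) t := fun i t =>
    ((hdiff2 i _).hasDerivAt.comp t (hline i t)).mul_const (d i)
  have hy1 : ∀ t ∈ Set.Icc (0 : ℝ) 1, ∀ i, 1 + x i (u i + t * d i) ≠ 0 := fun t ht i => by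
    linarith [hy t ht i]
  have hb : ∀ t ∈ Set.Icc (0 : ℝ) 1, 0 < 1 + ∑ i, Real.log (1 + x i (u i + t * d i)) :=
    fun t ht => add_pos_of_pos_of_nonneg one_pos <|
      Finset.sum_nonneg fun i _ => Real.log_nonneg (by linarith [hy t ht i])
  have hb' : ∀ t ∈ Set.Icc (0 : ℝ) 1,
      HasDerivAt (fun s => 1 + ∑ i, Real.log (1 + x i (u i + s * d i)))
        (∑ i, deriv (x i) (u i + t * d i) * d i / (1 + x i (u i + t * d i))) t := fun t ht =>
    (HasDerivAt.fun_sum fun i _ => ((hx i t).const_add 1).log (hy1 t ht i)).const_add 1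
  have hb'' : ∀ t ∈ Set.Icc (0 : ℝ) 1, HasDerivAt
      (fun s => ∑ i, deriv (x i) (u i + s * d i) * d i / (1 + x i (u i + s * d i))) _ t :=
    fun t ht => HasDerivAt.fun_sum fun i _ =>
      (hx' i t).fun_div ((hx i t).const_add 1) (hy1 t ht i)
  simp only [hU, Pi.add_apply, Pi.smul_apply, smul_eq_mul]
  refine strictConcaveOn_of_hasDerivAt2_neg (convex_Icc 0 1)
    (fun t ht => (((hb' t ht).log (hb t ht).ne').const_mul lam).fun_sub
      (HasDerivAt.fun_sum fun i _ => (hline i t).fun_mul (hx i t)))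
    (fun t ht => (((hb'' t ht).fun_div (hb' t ht) (hb t ht).ne').const_mul lam).fun_sub
      (HasDerivAt.fun_sum fun i _ =>
        ((hx i t).const_mul (d i)).fun_add ((hline i t).fun_mul (hx' i t))))
    fun t ht => ?_
  exact payoff_second_deriv_neg hlam (hb t ht) (hy t ht)
    (fun i => hd1 i _ (hSsub (hmem t ht) i trivial))
    (fun i => hd2 i _ (hSsub (hmem t ht) i trivial))
    (hbound _ (hmem t ht)) (sub_ne_zero.2 huv.symm)
end

section
/- Fix λ > 0 and N ≥ 1. For each n, let x_n : ℝ → ℝ be twice differentiable and continuous, and let I_n be an interval such that x_n(p) ≥ 0, x_n'(p) > 0, and x_n''(p) ≤ 0 for all p ∈ I_n. Let S ⊆ ∏_{n=1}^N I_n be a nonempty, compact, convex set such that for every p ∈ S and every n, p_n ≤ λ / ((1 + Σ_{i=1}^N ln(1 + x_i(p_i)))·(1 + x_n(p_n))). Then the SP payoff U(p) = λ·ln(1 + Σ_{i=1}^N ln(1 + x_i(p_i))) − Σ_{i=1}^N p_i·x_i(p_i) attains its maximum over S at exactly one point: there exists a unique p* ∈ S with U(p*) ≥ U(p) for all p ∈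 S. -/
/-- A function on a set of a real vector space is strictly concave if it is strictly concave along
every nondegenerate segment of the set. -/
theorem strictConcaveOn_of_forall_segment {E : Type*} [AddCommGroup E] [Module ℝ E]
    {S : Set E} {U : E → ℝ} (hS : Convex ℝ S)
    (h : ∀ p ∈ S, ∀ q ∈ S, p ≠ q →
      StrictConcaveOn ℝ (Set.Icc (0 : ℝ) 1) fun t => U (p + t • (q - p))) :
    StrictConcaveOn ℝ S U := by
  refine ⟨hS, fun p hp q hq hpq a b ha hb hab => ?_⟩
  have key := (h p hp q hq hpq).2 (Set.left_mem_Icc.2 zero_le_one)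
    (Set.right_mem_Icc.2 zero_le_one) zero_ne_one ha hb hab
  have hmid : p + b • (q - p) = a • p + b • q := by
    rw [← eq_sub_iff_add_eq] at hab
    subst hab
    module
  simpa [hmid] using key

section Payoff

variable {ι : Type*} [Fintype ι] {lam t : ℝ} {x : ι → ℝ → ℝ} {p d : ι → ℝ}

theorem hasDerivAt_comp_line {f : ℝ → ℝ} (hf : Differentiable ℝ f) (a b t : ℝ) :
    HasDerivAt (fun t => f (a + t * b)) (deriv f (a + t * b) * b) t := by
  have h : HasDerivAt (fun t : ℝ => a + t * b) b t := by
    simpa using ((hasDerivAt_id t).mul_const b).const_add a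
  exact (hf _).hasDerivAt.comp t h

theorem hasDerivAt_sum_log_line (hdiff : ∀ n, Differentiable ℝ (x n))
    (hx : ∀ i, 0 ≤ x i (p i + t * d i)) :
    HasDerivAt (fun t => 1 + ∑ i, Real.log (1 + x i (p i + t * d i)))
      (∑ i, deriv (x i) (p i + t * d i) * d i / (1 + x i (p i + t * d i))) t := by
  refine (HasDerivAt.fun_sum fun i _ => ?_).const_add 1
  exact ((hasDerivAt_comp_line (hdiff i) _ _ t).const_add 1).log (by linarith [hx i])

theorem one_add_sum_log_pos {y : ι → ℝ} (hy : ∀ i, 0 ≤ y i) :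
    0 < 1 + ∑ i, Real.log (1 + y i) := by
  have : 0 ≤ ∑ i, Real.log (1 + y i) :=
    Finset.sum_nonneg fun i _ => Real.log_nonneg (by linarith [hy i])
  linarith

theorem hasDerivAt_payoff_line (hdiff : ∀ n, Differentiable ℝ (x n))
    (hx : ∀ i, 0 ≤ x i (p i + t * d i)) :
    HasDerivAt (fun t => lam * Real.log (1 + ∑ i, Real.log (1 + x i (p i + t * d i)))
        - ∑ i, (p i + t * d i) * x i (p i + t * d i))
      (lam * ((∑ i, deriv (x i) (p i + t * d i) * d i / (1 + x i (p i + t * d i))) /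
          (1 + ∑ i, Real.log (1 + x i (p i + t * d i))))
        - ∑ i, (d i * x i (p i + t * d i)
          + (p i + t * d i) * (deriv (x i) (p i + t * d i) * d i))) t := by
  refine (((hasDerivAt_sum_log_line hdiff hx).log (one_add_sum_log_pos hx).ne').const_mul
    lam).sub (HasDerivAt.fun_sum fun i _ => ?_)
  have h := hasDerivAt_comp_line differentiable_id (p i) (d i) t
  simp only [deriv_id', id, one_mul] at h
  exact h.mul (hasDerivAt_comp_line (hdiff i) _ _ t)

theorem exists_neg_hasDerivAt_payoff_line (hlam : 0 < lam) (hd : d ≠ 0)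
    (hdiff : ∀ n, Differentiable ℝ (x n)) (hdiff2 : ∀ n, Differentiable ℝ (deriv (x n)))
    (hx : ∀ i, 0 ≤ x i (p i + t * d i))
    (hd1 : ∀ i, 0 < deriv (x i) (p i + t * d i))
    (hd2 : ∀ i, deriv (deriv (x i)) (p i + t * d i) ≤ 0)
    (hbound : ∀ n, p n + t * d n ≤ lam /
      ((1 + ∑ i, Real.log (1 + x i (p i + t * d i))) * (1 + x n (p n + t * d n)))) :
    ∃ c < 0, HasDerivAt (fun t =>
      lam * ((∑ i, deriv (x i) (p i + t * d i) * d i / (1 + x i (p i + t * d i))) /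
          (1 + ∑ i, Real.log (1 + x i (p i + t * d i))))
        - ∑ i, (d i * x i (p i + t * d i)
          + (p i + t * d i) * (deriv (x i) (p i + t * d i) * d i))) c t := by
  have hA := one_add_sum_log_pos hx
  have hB : HasDerivAt
      (fun t => ∑ i, deriv (x i) (p i + t * d i) * d i / (1 + x i (p i + t * d i)))
      (∑ i, (deriv (deriv (x i)) (p i + t * d i) * d i * d i * (1 + x i (p i + t * d i))
        - deriv (x i) (p i + t * d i) * d i * (deriv (x i) (p i + t * d i) * d i))
          / (1 + x i (p i + t * d i)) ^ 2) t :=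
    HasDerivAt.fun_sum fun i _ =>
      ((hasDerivAt_comp_line (hdiff2 i) _ _ t).mul_const (d i)).fun_div
        ((hasDerivAt_comp_line (hdiff i) _ _ t).const_add 1) (by linarith [hx i])
  have hC : HasDerivAt (fun t => ∑ i, (d i * x i (p i + t * d i)
          + (p i + t * d i) * (deriv (x i) (p i + t * d i) * d i)))
      (∑ i, (d i * (deriv (x i) (p i + t * d i) * d i)
        + (d i * (deriv (x i) (p i + t * d i) * d i)
          + (p i + t * d i) * (deriv (deriv (x i)) (p i + t * d i) * d i * d i)))) t := by
    refine HasDerivAt.fun_sum fun i _ => ?_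
    have h := hasDerivAt_comp_line differentiable_id (p i) (d i) t
    simp only [deriv_id', id, one_mul] at h
    exact ((hasDerivAt_comp_line (hdiff i) _ _ t).const_mul (d i)).add
      (h.mul ((hasDerivAt_comp_line (hdiff2 i) _ _ t).mul_const (d i)))
  refine ⟨_, ?_, ((hB.fun_div (hasDerivAt_sum_log_line hdiff hx) hA.ne').const_mul lam).fun_sub hC⟩
  set A := 1 + ∑ i, Real.log (1 + x i (p i + t * d i))
  set B := ∑ i, deriv (x i) (p i + t * d i) * d i / (1 + x i (p i + t * d i))
  rw [sub_neg]
  have hterm : ∀ i, lam / A * ((deriv (deriv (x i)) (p i + t * d i) * d i * d i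
        * (1 + x i (p i + t * d i))
        - deriv (x i) (p i + t * d i) * d i * (deriv (x i) (p i + t * d i) * d i))
          / (1 + x i (p i + t * d i)) ^ 2) + 2 * deriv (x i) (p i + t * d i) * d i ^ 2
      ≤ d i * (deriv (x i) (p i + t * d i) * d i)
        + (d i * (deriv (x i) (p i + t * d i) * d i)
          + (p i + t * d i) * (deriv (deriv (x i)) (p i + t * d i) * d i * d i)) := by
    intro i
    have hb := hbound i
    have h2 := hd2 i
    have hy : 0 < 1 + x i (p i + t * d i) := by linarith [hx i]
    generalize 1 + x i (p i + t * d i) = y at *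
    generalize deriv (deriv (x i)) (p i + t * d i) = x2 at *
    generalize deriv (x i) (p i + t * d i) = x1 at *
    generalize p i + t * d i = P at *
    have h1 : (lam / (A * y) - P) * x2 * d i ^ 2 ≤ 0 :=
      mul_nonpos_of_nonpos_of_nonneg
        (mul_nonpos_of_nonneg_of_nonpos (sub_nonneg.2 hb) h2) (sq_nonneg _)
    have h3 : 0 ≤ lam / A * (x1 * d i / y) ^ 2 := by positivity
    have h4 : lam / A * ((x2 * d i * d i * y - x1 * d i * (x1 * d i)) / y ^ 2)
        = lam / (A * y) * x2 * d i ^ 2 - lam / A * (x1 * d i / y) ^ 2 := by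
      field_simp
    rw [h4]
    linarith
  have hpos : 0 < ∑ i, 2 * deriv (x i) (p i + t * d i) * d i ^ 2 := by
    obtain ⟨j, hj⟩ := Function.ne_iff.1 hd
    refine Finset.sum_pos' (fun i _ => ?_) ⟨j, Finset.mem_univ j, ?_⟩
    · have := hd1 i
      positivity
    · have := hd1 j
      have : d j ≠ 0 := hj
      positivity
  have hsum := Finset.sum_le_sum fun i (_ : i ∈ Finset.univ) => hterm i
  rw [Finset.sum_add_distrib, ← Finset.mul_sum] at hsum
  refine lt_of_le_of_lt ?_ ((lt_add_of_pos_right _ hpos).trans_le hsum)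
  generalize (∑ i, (deriv (deriv (x i)) (p i + t * d i) * d i * d i * (1 + x i (p i + t * d i))
        - deriv (x i) (p i + t * d i) * d i * (deriv (x i) (p i + t * d i) * d i))
          / (1 + x i (p i + t * d i)) ^ 2) = B'
  have h5 : lam * ((B' * A - B * B) / A ^ 2) = lam / A * B' - lam * (B / A) ^ 2 := by
    field_simp
  rw [h5]
  have : 0 ≤ lam * (B / A) ^ 2 := by positivity
  linarith

end Payoff

/-- Lemma 3: under the best-response monotonicity/concavity assumptions and
the Lemma-2 price bound, the SP payoff
`U(p) = λ ln(1 + Σᵢ ln(1 + xᵢ(pᵢ))) - Σᵢ pᵢ xᵢ(pᵢ)` attains its maximum over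
the nonempty compact convex set `S` at exactly one point. -/
theorem stmt_15 (lam : ℝ) (hlam : 0 < lam) (N : ℕ) (hN : 1 ≤ N)
    (x : Fin N → ℝ → ℝ)
    (hdiff : ∀ n, Differentiable ℝ (x n))
    (hdiff2 : ∀ n, Differentiable ℝ (deriv (x n)))
    (hcont : ∀ n, Continuous (x n))
    (I : Fin N → Set ℝ) (hI : ∀ n, (I n).OrdConnected)
    (hpos : ∀ n, ∀ p ∈ I n, 0 ≤ x n p)
    (hd1 : ∀ n, ∀ p ∈ I n, 0 < deriv (x n) p)
    (hd2 : ∀ n, ∀ p ∈ I n, deriv (deriv (x n)) p ≤ 0)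
    (S : Set (Fin N → ℝ)) (hSsub : S ⊆ Set.univ.pi I)
    (hSne : S.Nonempty) (hScomp : IsCompact S) (hSconv : Convex ℝ S)
    (hbound : ∀ p ∈ S, ∀ n, p n ≤
      lam / ((1 + ∑ i, Real.log (1 + x i (p i))) * (1 + x n (p n))))
    (U : (Fin N → ℝ) → ℝ)
    (hU : ∀ p, U p = lam * Real.log (1 + ∑ i, Real.log (1 + x i (p i)))
      - ∑ i, p i * x i (p i)) :
    ∃! pstar : Fin N → ℝ, pstar ∈ S ∧ ∀ p ∈ S, U p ≤ U pstar := by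
  have hconc : StrictConcaveOn ℝ S U := by
    refine strictConcaveOn_of_forall_segment hSconv fun p hp q hq hpq => ?_
    have hd : q - p ≠ 0 := sub_ne_zero.2 hpq.symm
    have hmem : ∀ t ∈ Set.Icc (0 : ℝ) 1, p + t • (q - p) ∈ S := fun t ht =>
      hSconv.add_smul_sub_mem hp hq ht
    have hmemI : ∀ t ∈ Set.Icc (0 : ℝ) 1, ∀ i, p i + t * (q - p) i ∈ I i := fun t ht i =>
      hSsub (hmem t ht) i trivial
    have hUline : (fun t : ℝ => U (p + t • (q - p))) = fun t =>
        lam * Real.log (1 + ∑ i, Real.log (1 + x i (p i + t * (q - p) i)))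
          - ∑ i, (p i + t * (q - p) i) * x i (p i + t * (q - p) i) := by
      funext t
      simp only [hU, Pi.add_apply, Pi.smul_apply, smul_eq_mul]
    rw [hUline]
    have hderiv := fun t (ht : t ∈ Set.Icc (0 : ℝ) 1) =>
      hasDerivAt_payoff_line (lam := lam) hdiff fun i => hpos i _ (hmemI t ht i)
    refine strictConcaveOn_of_deriv2_neg (convex_Icc 0 1)
      (fun t ht => (hderiv t ht).continuousAt.continuousWithinAt) fun t ht => ?_
    rw [interior_Icc] at ht
    have ht' := Set.Ioo_subset_Icc_self ht
    obtain ⟨c, hc, hc'⟩ := exists_neg_hasDerivAt_payoff_line hlam hd hdiff hdiff2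
      (fun i => hpos i _ (hmemI t ht' i)) (fun i => hd1 i _ (hmemI t ht' i))
      (fun i => hd2 i _ (hmemI t ht' i)) (fun i => hbound _ (hmem t ht') i)
    have hev := Filter.eventually_of_mem (isOpen_Ioo.mem_nhds ht) fun s hs =>
      (hderiv s (Set.Ioo_subset_Icc_self hs)).deriv
    rw [Function.iterate_succ_apply, Function.iterate_one,
      (hc'.congr_of_eventuallyEq hev).deriv]
    exact hc
  have hUcont : ContinuousOn U S := by
    intro p hp
    have hx : ∀ i, 0 ≤ x i (p i) := fun i => hpos i _ (hSsub hp i trivial)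
    have hxc : ∀ i, ContinuousAt (fun p : Fin N → ℝ => x i (p i)) p := fun i =>
      ((hcont i).comp (continuous_apply i)).continuousAt
    rw [funext hU]
    refine ContinuousAt.continuousWithinAt (ContinuousAt.sub ?_ ?_)
    · refine continuousAt_const.mul (ContinuousAt.log (continuousAt_const.add
        (tendsto_finsetSum _ fun i _ => ?_)) (one_add_sum_log_pos hx).ne')
      exact (continuousAt_const.add (hxc i)).log (add_pos_of_pos_of_nonneg one_pos (hx i)).ne'
    · exact tendsto_finsetSum _ fun i _ => (continuous_apply i).continuousAt.mul (hxc i)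
  obtain ⟨pstar, hmem, hmax⟩ := hScomp.exists_isMaxOn hSne hUcont
  exact ⟨pstar, ⟨hmem, fun p hp => hmax hp⟩, fun q hq =>
    hconc.eq_of_isMaxOn (fun p hp => hq.2 p hp) hmax hq.1 hmem⟩
end
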